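/- Let E, F ⊆ ℝ² be convex sets of equal area, both containing a unit equilateral triangle T (with the maximal-triangle property E ∩ F ⊆ −2T), and suppose |E Δ F| ≤ 1/2 and E, F ⊆ 10T. Let K = co(E ∪ F). Then |K \ (E ∪ F)| ≤ 10·|E Δ F|. -/

import Mathlib

open Pointwise Real MeasureTheory

open Set

/-- The Euclidean plane. -/
abbrev Plane := EuclideanSpace ℝ (Fin 2)

/-- The determinant of two plane vectors. -/
def cross (x y : Plane) : ℝ := x 0 * y 1 - x 1 * y 0

lemma cross_smul_eq (p q x : Plane) : cross p q • x = cross x q • p + cross p x • q := by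
  ext i
  fin_cases i <;> simp [cross] <;> ring

lemma cross_linear_left (p q : Plane) (a b : ℝ) : cross (a • p + b • q) q = a * cross p q := by
  simp [cross]; ring

lemma cross_linear_right (p q : Plane) (a b : ℝ) : cross p (a • p + b • q) = b * cross p q := by
  simp [cross]; ring

/-- The open convex cone spanned by `p` and `q`. -/
def sector (p q : Plane) : Set Plane := {x | ∃ a b : ℝ, 0 < a ∧ 0 < b ∧ x = a • p + b • q}

lemma sector_comm (p q : Plane) : sector p q = sector q p := by
  ext x
  constructor <;> rintro ⟨a, b, ha, hb, rfl⟩ <;> exact ⟨b, a, hb, ha, add_comm _ _⟩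

lemma smul_add_smul_cross {p q : Plane} (h : cross p q ≠ 0) (x : Plane) :
    x = (cross x q / cross p q) • p + (cross p x / cross p q) • q := by
  have := congrArg (fun z => (cross p q)⁻¹ • z) (cross_smul_eq p q x)
  simp only [smul_add, smul_smul, inv_mul_cancel₀ h, one_smul] at this
  rw [div_eq_inv_mul, div_eq_inv_mul]
  exact this

lemma sector_eq {p q : Plane} (h : cross p q ≠ 0) :
    sector p q = {x | 0 < cross x q / cross p q ∧ 0 < cross p x / cross p q} := by
  ext x
  constructor
  · rintro ⟨a, b, ha, hb, rfl⟩
    rw [mem_ofPred_eq, cross_linear_left, cross_linear_right, mul_div_cancel_right₀ _ h,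
      mul_div_cancel_right₀ _ h]
    exact ⟨ha, hb⟩
  · rintro ⟨ha, hb⟩
    exact ⟨_, _, ha, hb, smul_add_smul_cross h x⟩

lemma continuous_cross_left (q : Plane) : Continuous fun x => cross x q := by
  unfold cross; fun_prop

lemma continuous_cross_right (p : Plane) : Continuous fun x => cross p x := by
  unfold cross; fun_prop

lemma isOpen_sector {p q : Plane} (h : cross p q ≠ 0) : IsOpen (sector p q) := by
  rw [sector_eq h]
  exact (isOpen_lt continuous_const ((continuous_cross_left q).div_const _)).inter
    (isOpen_lt continuous_const ((continuous_cross_right p).div_const _))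

lemma exists_of_mem_closure_sector {p q x : Plane} (h : cross p q ≠ 0)
    (hx : x ∈ closure (sector p q)) : ∃ a b : ℝ, 0 ≤ a ∧ 0 ≤ b ∧ x = a • p + b • q := by
  have hcl : IsClosed {x | 0 ≤ cross x q / cross p q ∧ 0 ≤ cross p x / cross p q} :=
    (isClosed_le continuous_const ((continuous_cross_left q).div_const _)).inter
      (isClosed_le continuous_const ((continuous_cross_right p).div_const _))
  have hsub : sector p q ⊆ {x | 0 ≤ cross x q / cross p q ∧ 0 ≤ cross p x / cross p q} := by
    rw [sector_eq h]
    exact fun x hx => ⟨hx.1.le, hx.2.le⟩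
  obtain ⟨ha, hb⟩ := closure_minimal hsub hcl hx
  exact ⟨_, _, ha, hb, smul_add_smul_cross h x⟩

lemma convex_sector (p q : Plane) : Convex ℝ (sector p q) := by
  rw [convex_iff_forall_pos]
  rintro _ ⟨a, b, ha, hb, rfl⟩ _ ⟨c, d, hc, hd, rfl⟩ s t hs ht -
  refine ⟨s * a + t * c, s * b + t * d, by positivity, by positivity, ?_⟩
  module

lemma smul_mem_sector {p q x : Plane} {r : ℝ} (hr : 0 < r) (hx : x ∈ sector p q) :
    r • x ∈ sector p q := by
  obtain ⟨a, b, ha, hb, rfl⟩ := hx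
  exact ⟨r * a, r * b, by positivity, by positivity, by module⟩

/-- The open triangle with vertex `y` and edge vectors `u` and `v`. -/
def openTriangle (y u v : Plane) : Set Plane :=
  {x | ∃ l n : ℝ, 0 < l ∧ 0 < n ∧ l + n < 1 ∧ x = y + l • u + n • v}

lemma volume_openTriangle (y u v : Plane) :
    volume (openTriangle y u v) = ENNReal.ofReal |cross u v| *
      volume {x : Plane | 0 < x 0 ∧ 0 < x 1 ∧ x 0 + x 1 < 1} := by
  let f : Plane →ₗ[ℝ] Plane :=
    { toFun := fun x => x 0 • u + x 1 • v
      map_add' := fun x z => by simp only [PiLp.add_apply]; module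
      map_smul' := fun c x => by simp only [PiLp.smul_apply, smul_eq_mul, RingHom.id_apply]; module }
  have hdet : LinearMap.det f = cross u v := by
    rw [← LinearMap.det_toMatrix (EuclideanSpace.basisFun (Fin 2) ℝ).toBasis f, Matrix.det_fin_two]
    simp [LinearMap.toMatrix_apply, f, cross]
    ring
  have himage : openTriangle y u v =
      (fun x => y + x) '' (f '' {x : Plane | 0 < x 0 ∧ 0 < x 1 ∧ x 0 + x 1 < 1}) := by
    ext x
    constructor
    · rintro ⟨l, n, hl, hn, hln, rfl⟩
      exact ⟨_, ⟨!₂[l, n], by simpa using ⟨hl, hn, hln⟩, rfl⟩, by simp [f, add_assoc]⟩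
    · rintro ⟨_, ⟨z, ⟨h0, h1, h2⟩, rfl⟩, rfl⟩
      exact ⟨z 0, z 1, h0, h1, h2, by simp [f, add_assoc]⟩
  rw [himage, image_add_left, measure_preimage_add, Measure.addHaar_image_linearMap, hdet]

lemma volume_openTriangle_smul (y u v : Plane) (k : ℝ) :
    volume (openTriangle y u (k • v)) = ENNReal.ofReal |k| * volume (openTriangle y u v) := by
  have : cross u (k • v) = k * cross u v := by simp [cross]; ring
  rw [volume_openTriangle, volume_openTriangle, this, abs_mul, ENNReal.ofReal_mul (abs_nonneg _),
    mul_assoc]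

lemma gauge_combination_le {E : Set Plane} (hE : Convex ℝ E) (h0 : E ∈ nhds 0) {a b : ℝ}
    (ha : 0 ≤ a) (hb : 0 ≤ b) {x z : Plane} (hx : x ∈ E) (hz : z ∈ E) :
    gauge E (a • x + b • z) ≤ a + b := by
  refine (gauge_add_le hE (absorbent_nhds_zero h0) _ _).trans ?_
  rw [gauge_smul_of_nonneg ha, gauge_smul_of_nonneg hb, smul_eq_mul, smul_eq_mul]
  nlinarith [gauge_le_one_of_mem hx, gauge_le_one_of_mem hz]

lemma gauge_le_one_iff_mem {E : Set Plane} (hE : Convex ℝ E) (h0 : E ∈ nhds 0) (hc : IsClosed E)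
    {x : Plane} : gauge E x ≤ 1 ↔ x ∈ E := by
  rw [gauge_le_one_iff_mem_closure hE h0, hc.closure_eq]

lemma combination_mem {E : Set Plane} (hE : Convex ℝ E) (h0 : E ∈ nhds 0) {a b : ℝ}
    (ha : 0 ≤ a) (hb : 0 ≤ b) (hab : a + b ≤ 1) {x z : Plane} (hx : x ∈ E) (hz : z ∈ E) :
    a • x + b • z ∈ E := by
  have := hE.sum_mem (t := Finset.univ) (w := ![a, b, 1 - a - b]) (z := ![x, z, 0])
    (by intro i _; fin_cases i <;> simp <;> linarith) (by simp [Fin.sum_univ_three])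
    (by intro i _; fin_cases i <;> simp [hx, hz, mem_of_mem_nhds h0])
  simpa [Fin.sum_univ_three] using this

/-- The boundaries of `E` and `F` meet inside the triangle `0 p q`, away from the sides `0 p` and
`0 q`. -/
lemma exists_common_boundary_point {E F : Set Plane} (hE : Convex ℝ E) (hF : Convex ℝ F)
    (hEc : IsClosed E) (hFc : IsClosed F) (hE0 : E ∈ nhds 0) (hF0 : F ∈ nhds 0) {p q : Plane}
    (hp : p ∈ E) (hq : q ∈ F) (hseg : ∀ x ∈ openSegment ℝ p q, x ∉ E ∪ F) :
    ∃ α β : ℝ, 0 < α ∧ 0 < β ∧ α + β < 1 ∧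
      gauge E (α • p + β • q) = 1 ∧ gauge F (α • p + β • q) = 1 := by
  have hmid : (1 / 2 : ℝ) • p + (1 / 2 : ℝ) • q ∉ E ∪ F :=
    hseg _ ⟨_, _, by norm_num, by norm_num, by norm_num, rfl⟩
  have hpF : p ∉ F := fun h =>
    hmid (Or.inr (hF h hq (by norm_num) (by norm_num) (by norm_num)))
  have hqE : q ∉ E := fun h =>
    hmid (Or.inl (hE hp h (by norm_num) (by norm_num) (by norm_num)))
  rw [← gauge_le_one_iff_mem hF hF0 hFc, not_le] at hpF
  rw [← gauge_le_one_iff_mem hE hE0 hEc, not_le] at hqE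
  have hcont : Continuous fun t : ℝ =>
      gauge E ((1 - t) • p + t • q) - gauge F ((1 - t) • p + t • q) :=
    ((continuous_gauge hE hE0).comp (by fun_prop)).sub
      ((continuous_gauge hF hF0).comp (by fun_prop))
  obtain ⟨t, ⟨ht0, ht1⟩, ht⟩ := intermediate_value_Icc zero_le_one hcont.continuousOn
    (show (0 : ℝ) ∈ _ by
      constructor <;> simp
      · linarith [gauge_le_one_of_mem hp]
      · linarith [gauge_le_one_of_mem hq])
  rw [sub_eq_zero] at ht
  have ht0' : 0 < t := by
    refine lt_of_le_of_ne ht0 fun h => ?_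
    subst h
    simp at ht
    linarith [gauge_le_one_of_mem hp]
  have ht1' : t < 1 := by
    refine lt_of_le_of_ne ht1 fun h => ?_
    subst h
    simp at ht
    linarith [gauge_le_one_of_mem hq]
  have hz : (1 - t) • p + t • q ∉ E := fun h =>
    hseg _ ⟨1 - t, t, by linarith, ht0', by ring, rfl⟩ (Or.inl h)
  rw [← gauge_le_one_iff_mem hE hE0 hEc, not_le] at hz
  set g := gauge E ((1 - t) • p + t • q) with hg
  have hg0 : 0 < g := by linarith
  have hy : (g⁻¹ * (1 - t)) • p + (g⁻¹ * t) • q = g⁻¹ • ((1 - t) • p + t • q) := by module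
  refine ⟨g⁻¹ * (1 - t), g⁻¹ * t, by have := sub_pos.2 ht1'; positivity, by positivity, ?_, ?_, ?_⟩
  · rw [← mul_add, sub_add_cancel, mul_one]
    exact inv_lt_one_of_one_lt₀ hz
  · rw [hy, gauge_smul_of_nonneg (by positivity), ← hg, smul_eq_mul, inv_mul_cancel₀ hg0.ne']
  · rw [hy, gauge_smul_of_nonneg (by positivity), ← ht, smul_eq_mul, inv_mul_cancel₀ hg0.ne']

/-- Part of `sector p q` below the line `p q` and outside `E ∪ F` lies in the triangle `y p q`. -/
lemma mem_openTriangle_of_notMem {E F : Set Plane} (hE : Convex ℝ E) (hF : Convex ℝ F)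
    (hE0 : E ∈ nhds 0) (hF0 : F ∈ nhds 0) {p q : Plane} {α β a b : ℝ}
    (hp : p ∈ E) (hq : q ∈ F) (hα : 0 < α) (hβ : 0 < β) (hαβ : α + β < 1)
    (hyE : α • p + β • q ∈ E) (hyF : α • p + β • q ∈ F) (ha : 0 < a) (hb : 0 < b) (hab : a + b < 1)
    (hxE : a • p + b • q ∉ E) (hxF : a • p + b • q ∉ F) :
    a • p + b • q ∈
      openTriangle (α • p + β • q) (p - (α • p + β • q)) (q - (α • p + β • q)) := by
  set m := (1 - a - b) / (1 - α - β) with hm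
  have hD : 0 < 1 - α - β := by linarith
  have hmD : m * (1 - α - β) = 1 - a - b := div_mul_cancel₀ _ hD.ne'
  have hm0 : 0 < m := div_pos (by linarith) hD
  have key : 0 < a - m * α ∧ 0 < b - m * β := by
    rcases le_total (b * α) (a * β) with h | h
    · have hn : 0 < b - m * β := by
        by_contra! hcon
        refine hxE ?_
        have hs : 0 ≤ a - b / β * α := by
          rw [div_mul_eq_mul_div, sub_nonneg, div_le_iff₀ hβ]; exact h
        have := combination_mem hE hE0 hs (div_nonneg hb.le hβ.le) ?_ hp hyE
        · convert this using 1
          rw [smul_add, smul_smul, smul_smul, div_mul_cancel₀ _ hβ.ne']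
          module
        · have h1 : b / β ≤ m := by rw [div_le_iff₀ hβ]; linarith
          have h2 : b = b / β * β := (div_mul_cancel₀ _ hβ.ne').symm
          nlinarith
      refine ⟨?_, hn⟩
      have : 0 < (a - m * α) * β := by nlinarith
      exact pos_of_mul_pos_left this hβ.le
    · have hl : 0 < a - m * α := by
        by_contra! hcon
        refine hxF ?_
        have hs : 0 ≤ b - a / α * β := by
          rw [div_mul_eq_mul_div, sub_nonneg, div_le_iff₀ hα]; exact h
        have := combination_mem hF hF0 hs (div_nonneg ha.le hα.le) ?_ hq hyF
        · convert this using 1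
          rw [smul_add, smul_smul, smul_smul, div_mul_cancel₀ _ hα.ne']
          module
        · have h1 : a / α ≤ m := by rw [div_le_iff₀ hα]; linarith
          have h2 : a = a / α * α := (div_mul_cancel₀ _ hα.ne').symm
          nlinarith
      refine ⟨hl, ?_⟩
      have : 0 < (b - m * β) * α := by nlinarith
      exact pos_of_mul_pos_left this hα.le
  refine ⟨a - m * α, b - m * β, key.1, key.2, by nlinarith, ?_⟩
  clear_value m
  match_scalars
  · linear_combination α * hmD
  · linear_combination β * hmD

/-- With `w` the point where the line `q y` meets the line `0 p`, the triangle `y p w` lies in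
`E \ F`. -/
lemma openTriangle_subset_diff {E F : Set Plane} (hE : Convex ℝ E) (hF : Convex ℝ F)
    (hE0 : E ∈ nhds 0) (hF0 : F ∈ nhds 0) {p q : Plane} {α β : ℝ}
    (hp : p ∈ E) (hq : q ∈ F) (hα : 0 < α) (hβ : 0 < β) (hαβ : α + β < 1)
    (hyE : α • p + β • q ∈ E) (hyF : gauge F (α • p + β • q) = 1) :
    openTriangle (α • p + β • q) (p - (α • p + β • q))
      ((-(β / (1 - β))) • (q - (α • p + β • q))) ⊆ (E \ F) ∩ sector p q := by
  rintro x ⟨l, n, hl, hn, hln, rfl⟩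
  have hβ1 : 0 < 1 - β := by linarith
  obtain ⟨κ, hκ⟩ : ∃ κ, κ = β / (1 - β) := ⟨_, rfl⟩
  have hκ0 : 0 < κ := hκ ▸ div_pos hβ hβ1
  have hκβ : κ * (1 - β) = β := by rw [hκ]; exact div_mul_cancel₀ _ hβ1.ne'
  rw [← hκ]
  obtain ⟨a, ha⟩ : ∃ a, a = α + l * (1 - α) + n * κ * α := ⟨_, rfl⟩
  obtain ⟨b, hb⟩ : ∃ b, b = β * (1 - l - n) := ⟨_, rfl⟩
  have ha0 : 0 < a := by
    have : 0 < l * (1 - α) := mul_pos hl (by linarith)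
    rw [ha]; positivity
  have hb0 : 0 < b := by rw [hb]; exact mul_pos hβ (by linarith)
  have hx : α • p + β • q + l • (p - (α • p + β • q)) + n • (-κ) • (q - (α • p + β • q)) =
      a • p + b • q := by
    match_scalars
    · linear_combination -ha
    · linear_combination -hb - n * hκβ
  rw [hx]
  refine ⟨⟨?_, fun hxF => ?_⟩, a, b, ha0, hb0, rfl⟩
  · have hs : 0 ≤ l + n * (κ + 1) * α := by positivity
    have hr : 0 ≤ 1 - l - n := by linarith
    have hκα : (κ + 1) * α ≤ 1 := by
      have : (κ + 1) * (1 - β) = 1 := by linarith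
      nlinarith
    convert combination_mem hE hE0 hs hr (by nlinarith) hp hyE using 1
    match_scalars
    · linear_combination ha
    · linear_combination hb
  · have hc2 : 0 < β - b * (α / a) := by
      have : β * a - b * α = β * (l + n * κ * α + n * α) := by rw [ha, hb]; ring
      have h2 : 0 < β * a - b * α := by rw [this]; positivity
      rw [mul_div_assoc', sub_pos, div_lt_iff₀ ha0]
      linarith
    have hle := gauge_combination_le hF hF0 (div_nonneg hα.le ha0.le) hc2.le hxF hq
    have hy : (α / a) • (a • p + b • q) + (β - b * (α / a)) • q = α • p + β • q := by
      rw [smul_add, smul_smul, div_mul_cancel₀ _ ha0.ne']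
      module
    rw [hy, hyF] at hle
    have h3 : a * (1 - β) - α * (1 - b) = l * (1 - α - β) := by
      rw [ha, hb]
      linear_combination n * α * hκβ
    have h4 : 0 < l * (1 - α - β) := mul_pos hl (by linarith)
    have h5 : α / a * (1 - b) < 1 - β := by
      rw [div_mul_eq_mul_div, div_lt_iff₀ ha0]
      linarith
    linarith

/-- The triangle `y p q` is at most ten times as large as the part of `E \ F` in `sector p q`. -/
lemma volume_openTriangle_le {E F : Set Plane} (hE : Convex ℝ E) (hF : Convex ℝ F)
    (hE0 : E ∈ nhds 0) (hF0 : F ∈ nhds 0) {p q : Plane} {α β : ℝ}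
    (hp : p ∈ E) (hq : q ∈ F) (hα : 0 < α) (hβ : 1 / 11 ≤ β) (hαβ : α + β < 1)
    (hyE : α • p + β • q ∈ E) (hyF : gauge F (α • p + β • q) = 1) :
    volume (openTriangle (α • p + β • q) (p - (α • p + β • q)) (q - (α • p + β • q))) ≤
      10 * volume ((E \ F) ∩ sector p q) := by
  have hκ : 1 / 10 ≤ β / (1 - β) := by
    rw [le_div_iff₀ (by linarith)]
    linarith
  have h := measure_mono (μ := volume)
    (openTriangle_subset_diff hE hF hE0 hF0 hp hq hα (by linarith) hαβ hyE hyF)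
  rw [volume_openTriangle_smul, abs_neg, abs_of_nonneg (by linarith)] at h
  refine le_trans ?_ (mul_le_mul_right h 10)
  rw [← mul_assoc]
  refine le_mul_of_one_le_left' ?_
  rw [show (10 : ENNReal) = ENNReal.ofReal 10 by simp, ← ENNReal.ofReal_mul (by norm_num),
    ENNReal.one_le_ofReal]
  linarith

lemma openTriangle_comm (y u v : Plane) : openTriangle y u v = openTriangle y v u := by
  ext x
  constructor <;> rintro ⟨l, n, hl, hn, hln, rfl⟩ <;>
    exact ⟨n, l, hn, hl, by linarith, by abel⟩

/-- A segment on a supporting line of the convex hull of `E ∪ F` that runs from a point of `E` to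
a point of `F` and avoids `E ∪ F` in between. -/
structure IsBridge (E F : Set Plane) (p q : Plane) : Prop where
  left_mem : p ∈ E
  right_mem : q ∈ F
  notMem : ∀ x ∈ openSegment ℝ p q, x ∉ E ∪ F
  exists_support : ∃ h : Plane →L[ℝ] ℝ, h p = 1 ∧ h q = 1 ∧
    (∀ x ∈ interior (convexHull ℝ (E ∪ F)), h x < 1) ∧ ∀ x ∈ convexHull ℝ (E ∪ F), h x ≤ 1

lemma IsBridge.volume_le {E F : Set Plane} (hE : Convex ℝ E) (hF : Convex ℝ F)
    (hEc : IsClosed E) (hFc : IsClosed F) (hE0 : E ∈ nhds 0) (hF0 : F ∈ nhds 0)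
    (hEF : ∀ x ∈ E, (1 / 10 : ℝ) • x ∈ F) {p q : Plane} (hpq : IsBridge E F p q) :
    volume ((interior (convexHull ℝ (E ∪ F)) \ (E ∪ F)) ∩ sector p q) ≤
      10 * volume (symmDiff E F ∩ sector p q) := by
  obtain ⟨hp, hq, hseg, h, hhp, hhq, hlt, -⟩ := hpq
  obtain ⟨α, β, hα, hβ, hαβ, hyE, hyF⟩ :=
    exists_common_boundary_point hE hF hEc hFc hE0 hF0 hp hq hseg
  have hyE' := (gauge_le_one_iff_mem hE hE0 hEc).1 hyE.le
  have hyF' := (gauge_le_one_iff_mem hF hF0 hFc).1 hyF.le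
  have hsub : (interior (convexHull ℝ (E ∪ F)) \ (E ∪ F)) ∩ sector p q ⊆
      openTriangle (α • p + β • q) (p - (α • p + β • q)) (q - (α • p + β • q)) := by
    rintro x ⟨⟨hxK, hxEF⟩, a, b, ha, hb, rfl⟩
    have hab := hlt _ hxK
    simp only [map_add, map_smul, hhp, hhq, smul_eq_mul, mul_one] at hab
    exact mem_openTriangle_of_notMem hE hF hE0 hF0 hp hq hα hβ hαβ hyE' hyF' ha hb hab
      (fun hx => hxEF (Or.inl hx)) (fun hx => hxEF (Or.inr hx))
  refine (measure_mono hsub).trans ?_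
  have h10 : 1 ≤ 10 * α + β := by
    have := gauge_combination_le hF hF0 (by positivity : 0 ≤ 10 * α) hβ.le (hEF p hp) hq
    rwa [smul_smul, show 10 * α * (1 / 10) = α by ring, hyF] at this
  rcases le_or_gt (1 / 11) β with hβ' | hβ'
  · refine (volume_openTriangle_le hE hF hE0 hF0 hp hq hα hβ' hαβ hyE' hyF).trans ?_
    gcongr
    exact subset_union_left
  · have hle := volume_openTriangle_le hF hE hF0 hE0 hq hp hβ (by linarith : 1 / 11 ≤ α)
      (by linarith) (by rwa [add_comm]) (by rwa [add_comm])
    rw [add_comm (β • q), openTriangle_comm, sector_comm q p] at hle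
    refine hle.trans ?_
    gcongr
    exact subset_union_right

lemma IsBridge.cross_ne_zero {E F : Set Plane} {p q : Plane} (hpq : IsBridge E F p q) :
    cross p q ≠ 0 := by
  intro h0
  obtain ⟨hp, hq, hseg, h, hhp, hhq, -, -⟩ := hpq
  have hz (z : Plane) : cross z (q - p) = 0 := by
    have := congrArg h (cross_smul_eq p q z)
    simp only [h0, map_add, map_smul, hhp, hhq, smul_eq_mul, mul_one, zero_mul] at this
    simp only [cross, PiLp.sub_apply] at this ⊢
    linarith
  have hqp : q = p := by
    have h1 := hz !₂[1, 0]
    have h2 := hz !₂[0, 1]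
    simp [cross] at h1 h2
    ext i
    fin_cases i <;> simp <;> linarith
  subst hqp
  refine hseg q ?_ (Or.inl hp)
  simp

/-- No point of `E ∪ F` on the supporting line of a bridge lies in the sector of another one. -/
lemma IsBridge.notMem_sector {E F : Set Plane} {p q x : Plane} (hpq : IsBridge E F p q)
    (hx : x ∈ E ∪ F) {h : Plane →L[ℝ] ℝ} (hhx : h x = 1)
    (hle : ∀ x ∈ convexHull ℝ (E ∪ F), h x ≤ 1) : x ∉ sector p q := by
  rintro ⟨a, b, ha, hb, rfl⟩
  obtain ⟨hp, hq, hseg, h', hhp, hhq, -, hle'⟩ := hpq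
  have h1 := hle' _ (subset_convexHull ℝ _ hx)
  have hp1 := hle _ (subset_convexHull ℝ _ (Or.inl hp))
  have hq1 := hle _ (subset_convexHull ℝ _ (Or.inr hq))
  simp only [map_add, map_smul, hhp, hhq, smul_eq_mul, mul_one] at h1 hhx
  have hab : a + b = 1 := by nlinarith
  exact hseg _ ⟨a, b, ha, hb, hab, rfl⟩ hx

lemma IsBridge.sector_subset {E F : Set Plane} {p q p' q' : Plane} (hpq : IsBridge E F p q)
    (hpq' : IsBridge E F p' q') (h : (sector p' q' ∩ sector p q).Nonempty) :
    sector p' q' ⊆ sector p q := by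
  refine (convex_sector p' q').isPreconnected.subset_of_closure_inter_subset
    (isOpen_sector hpq.cross_ne_zero) h ?_
  rintro x ⟨hx, hx'⟩
  obtain ⟨h, hhp, hhq, -, hle⟩ := hpq.exists_support
  obtain ⟨h', hhp', hhq', -, -⟩ := hpq'.exists_support
  obtain ⟨a, b, ha, hb, rfl⟩ := exists_of_mem_closure_sector hpq.cross_ne_zero hx
  have hne : a • p + b • q ≠ 0 := by
    intro h0
    rw [h0] at hx'
    obtain ⟨c, d, hc, hd, hcd⟩ := hx'
    have := congrArg h' hcd
    simp only [map_zero, map_add, map_smul, hhp', hhq', smul_eq_mul, mul_one] at this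
    linarith
  rcases ha.eq_or_lt with rfl | ha
  · rcases hb.eq_or_lt with rfl | hb
    · simp at hne
    · refine absurd ?_ (hpq'.notMem_sector (Or.inr hpq.right_mem) hhq hle)
      have := smul_mem_sector (inv_pos.2 hb) hx'
      simpa [smul_smul, inv_mul_cancel₀ hb.ne'] using this
  · rcases hb.eq_or_lt with rfl | hb
    · refine absurd ?_ (hpq'.notMem_sector (Or.inl hpq.left_mem) hhp hle)
      have := smul_mem_sector (inv_pos.2 ha) hx'
      simpa [smul_smul, inv_mul_cancel₀ ha.ne'] using this
    · exact ⟨a, b, ha, hb, rfl⟩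

lemma IsBridge.sector_eq_or_disjoint {E F : Set Plane} {p q p' q' : Plane}
    (hpq : IsBridge E F p q) (hpq' : IsBridge E F p' q') :
    sector p q = sector p' q' ∨ Disjoint (sector p q) (sector p' q') := by
  rw [or_iff_not_imp_right, not_disjoint_iff_nonempty_inter]
  intro h
  exact (hpq'.sector_subset hpq h).antisymm (hpq.sector_subset hpq' (by rwa [inter_comm]))

lemma isCompact_convexHull_union {E F : Set Plane} (hE : Convex ℝ E) (hF : Convex ℝ F)
    (hEc : IsCompact E) (hFc : IsCompact F) (hE0 : E.Nonempty) (hF0 : F.Nonempty) :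
    IsCompact (convexHull ℝ (E ∪ F)) := by
  have : convexHull ℝ (E ∪ F) =
      (fun z : ℝ × Plane × Plane => (1 - z.1) • z.2.1 + z.1 • z.2.2) '' (Icc 0 1 ×ˢ E ×ˢ F) := by
    rw [hE.convexHull_union hF hE0 hF0]
    ext x
    simp only [mem_convexJoin, segment_eq_image, mem_image, Prod.exists, mem_prod]
    constructor
    · rintro ⟨e, he, f, hf, t, ht, rfl⟩
      exact ⟨t, e, f, ⟨ht, he, hf⟩, rfl⟩
    · rintro ⟨t, e, f, ⟨ht, he, hf⟩, rfl⟩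
      exact ⟨e, he, f, hf, t, ht, rfl⟩
  rw [this]
  exact (isCompact_Icc.prod (hEc.prod hFc)).image (by fun_prop)

/-- On the segment from a point outside the closed set `S` to a point of `S` there is a first
point of `S`. -/
lemma exists_first_mem {S : Set Plane} (hS : IsClosed S) {k e : Plane} (hk : k ∉ S) (he : e ∈ S) :
    ∃ t : ℝ, 0 < t ∧ t ≤ 1 ∧ k + t • (e - k) ∈ S ∧
      ∀ s, 0 ≤ s → s < t → k + s • (e - k) ∉ S := by
  have hcpt : IsCompact (Icc (0 : ℝ) 1 ∩ (fun t : ℝ => k + t • (e - k)) ⁻¹' S) :=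
    isCompact_Icc.inter_right (hS.preimage (by fun_prop))
  obtain ⟨t, ⟨⟨ht0, ht1⟩, hpS⟩, hleast⟩ :=
    hcpt.exists_isLeast ⟨1, ⟨zero_le_one, le_rfl⟩, by simpa using he⟩
  refine ⟨t, lt_of_le_of_ne ht0 ?_, ht1, hpS, fun s hs hst hqS => ?_⟩
  · rintro rfl
    exact hk (by simpa using hpS)
  · exact hst.not_ge (hleast ⟨⟨hs, hst.le.trans ht1⟩, hqS⟩)

/-- A point outside the closed set `S` on a segment between points of `S` lies on a subsegment
whose interior avoids `S` and whose endpoints belong to `S`. -/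
lemma exists_openSegment_disjoint {S : Set Plane} (hS : IsClosed S) {k e f : Plane} (hkS : k ∉ S)
    (he : e ∈ S) (hf : f ∈ S) (hk : k ∈ segment ℝ e f) :
    ∃ p ∈ S, ∃ q ∈ S, k ∈ openSegment ℝ p q ∧ ∀ z ∈ openSegment ℝ p q, z ∉ S := by
  obtain ⟨u, v, hu, hv, huv, hkef⟩ := hk
  obtain ⟨t, ht0, ht1, htS, htmin⟩ := exists_first_mem hS hkS he
  obtain ⟨s, hs0, hs1, hsS, hsmin⟩ := exists_first_mem hS hkS hf
  have hu0 : 0 < u := by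
    refine lt_of_le_of_ne hu ?_
    rintro rfl
    refine hkS ?_
    rw [← hkef]
    simpa [show v = 1 by linarith] using hf
  have hv0 : 0 < v := by
    refine lt_of_le_of_ne hv ?_
    rintro rfl
    refine hkS ?_
    rw [← hkef]
    simpa [show u = 1 by linarith] using he
  have hrel : u • (e - k) + v • (f - k) = 0 := by
    rw [show u • (e - k) + v • (f - k) = (u • e + v • f) - (u + v) • k by module, hkef, huv]
    simp
  set p := k + t • (e - k) with hp
  set q := k + s • (f - k) with hq
  have hc : 0 < u / t + v / s := by positivity
  obtain ⟨A, hA⟩ : ∃ A, A = u / t / (u / t + v / s) := ⟨_, rfl⟩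
  obtain ⟨B, hB⟩ : ∃ B, B = v / s / (u / t + v / s) := ⟨_, rfl⟩
  have hA0 : 0 < A := by rw [hA]; positivity
  have hB0 : 0 < B := by rw [hB]; positivity
  have hAB : A + B = 1 := by rw [hA, hB]; field_simp
  have hkpq : k = A • p + B • q := by
    have h1 : A * t = u * (u / t + v / s)⁻¹ := by rw [hA]; field_simp
    have h2 : B * s = v * (u / t + v / s)⁻¹ := by rw [hB]; field_simp
    have : A • p + B • q = (A + B) • k + (u / t + v / s)⁻¹ • (u • (e - k) + v • (f - k)) := by
      rw [hp, hq, smul_add, smul_add, smul_smul, smul_smul, h1, h2]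
      module
    rw [this, hrel, hAB]
    simp
  refine ⟨p, htS, q, hsS, ⟨A, B, hA0, hB0, hAB, hkpq.symm⟩, ?_⟩
  rintro z ⟨a, b, ha, hb, hab, rfl⟩
  have hfk : f - k = (-(u / v)) • (e - k) := by
    have : v • (f - k) = (-u) • (e - k) := by
      rw [neg_smul]; exact eq_neg_of_add_eq_zero_right hrel
    rw [show -(u / v) = v⁻¹ * (-u) by ring, mul_smul, ← this, smul_smul,
      inv_mul_cancel₀ hv0.ne', one_smul]
  have hek : e - k = (-(v / u)) • (f - k) := by
    rw [hfk, smul_smul, show -(v / u) * -(u / v) = 1 by field_simp, one_smul]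
  have hbs : 0 < b * s := by positivity
  have hat : 0 < a * t := by positivity
  rcases le_total 0 (a * t - b * s * (u / v)) with hsgn | hsgn
  · have hz : a • p + b • q = k + (a * t - b * s * (u / v)) • (e - k) := by
      rw [hp, hq, hfk, show a = 1 - b by linarith]
      module
    rw [hz]
    refine htmin _ hsgn ?_
    have : 0 < b * s * (u / v) := by positivity
    nlinarith
  · have hz : a • p + b • q = k + (b * s - a * t * (v / u)) • (f - k) := by
      rw [hp, hq, hek, show a = 1 - b by linarith]
      module
    rw [hz]
    refine hsmin _ ?_ ?_
    · have : b * s - a * t * (v / u) = -(a * t - b * s * (u / v)) * (v / u) := by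
        field_simp
        ring
      rw [this]
      exact mul_nonneg (by linarith) (by positivity)
    · have : 0 < a * t * (v / u) := by positivity
      nlinarith

lemma exists_support_of_notMem_interior {K : Set Plane} (hK : Convex ℝ K)
    (h0 : (0 : Plane) ∈ interior K) {k : Plane} (hk : k ∉ interior K) :
    ∃ h : Plane →L[ℝ] ℝ, h k = 1 ∧ (∀ x ∈ interior K, h x < 1) ∧ ∀ x ∈ K, h x ≤ 1 := by
  obtain ⟨f, hf⟩ := geometric_hahn_banach_open_point hK.interior isOpen_interior hk
  have hpos : 0 < f k := by simpa using hf 0 h0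
  have hlt : ∀ x ∈ interior K, ((f k)⁻¹ • f) x < 1 := by
    intro x hx
    rw [smul_apply, smul_eq_mul, inv_mul_lt_iff₀ hpos, mul_one]
    exact hf x hx
  refine ⟨(f k)⁻¹ • f, by simp [hpos.ne'], hlt, fun x hx => ?_⟩
  have hx' : x ∈ closure (interior K) := by
    rw [hK.closure_interior_eq_closure_of_nonempty_interior ⟨0, h0⟩]
    exact subset_closure hx
  exact closure_minimal (fun z hz => (hlt z hz).le)
    (isClosed_le ((f k)⁻¹ • f).continuous continuous_const) hx'

lemma exists_isBridge {E F : Set Plane} (hE : Convex ℝ E) (hF : Convex ℝ F)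
    (hEc : IsCompact E) (hFc : IsCompact F) (hE0 : E ∈ nhds 0) (hF0 : F ∈ nhds 0) {x : Plane}
    (hxK : x ∈ interior (convexHull ℝ (E ∪ F))) (hx : x ∉ E ∪ F) :
    ∃ p q, IsBridge E F p q ∧ x ∈ sector p q := by
  have hEne : E.Nonempty := ⟨0, mem_of_mem_nhds hE0⟩
  have hFne : F.Nonempty := ⟨0, mem_of_mem_nhds hF0⟩
  have hKc := isCompact_convexHull_union hE hF hEc hFc hEne hFne
  have hKconv : Convex ℝ (convexHull ℝ (E ∪ F)) := convex_convexHull ℝ _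
  have hEK : E ⊆ convexHull ℝ (E ∪ F) := subset_union_left.trans (subset_convexHull ℝ _)
  have hK0 : convexHull ℝ (E ∪ F) ∈ nhds 0 := Filter.mem_of_superset hE0 hEK
  have hjoin := hE.convexHull_union hF hEne hFne
  set K := convexHull ℝ (E ∪ F) with hK
  have hx0 : x ≠ 0 := by
    rintro rfl
    exact hx (Or.inl (mem_of_mem_nhds hE0))
  set g := gauge K x with hg
  have hg0 : 0 < g := (gauge_pos (absorbent_nhds_zero hK0)
    (NormedSpace.isVonNBounded_iff ℝ |>.2 hKc.isBounded)).2 hx0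
  have hg1 : g < 1 := (gauge_lt_one_iff_mem_interior hKconv hK0).2 hxK
  have hgk : gauge K (g⁻¹ • x) = 1 := by
    rw [gauge_smul_of_nonneg (by positivity), ← hg, smul_eq_mul, inv_mul_cancel₀ hg0.ne']
  obtain ⟨k, hk⟩ : ∃ k, k = g⁻¹ • x := ⟨_, rfl⟩
  have hxk : x = g • k := by rw [hk, smul_smul, mul_inv_cancel₀ hg0.ne', one_smul]
  rw [← hk] at hgk
  have hkK : k ∈ K := (gauge_le_one_iff_mem hKconv hK0 hKc.isClosed).1 hgk.le
  have hkint : k ∉ interior K := by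
    rw [← gauge_lt_one_iff_mem_interior hKconv hK0, hgk]
    exact lt_irrefl 1
  have hkS : k ∉ E ∪ F := by
    rintro (h | h)
    · exact hx (Or.inl (hxk ▸ hE.smul_mem_of_zero_mem (mem_of_mem_nhds hE0) h ⟨hg0.le, hg1.le⟩))
    · exact hx (Or.inr (hxk ▸ hF.smul_mem_of_zero_mem (mem_of_mem_nhds hF0) h ⟨hg0.le, hg1.le⟩))
  have hScl : IsClosed (E ∪ F) := hEc.isClosed.union hFc.isClosed
  obtain ⟨e, he, f, hf, hkef⟩ : ∃ e ∈ E, ∃ f ∈ F, k ∈ segment ℝ e f := by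
    rwa [hjoin, mem_convexJoin] at hkK
  obtain ⟨p, hpS, q, hqS, hkseg, hseg⟩ :=
    exists_openSegment_disjoint hScl hkS (Or.inl he) (Or.inr hf) hkef
  obtain ⟨A, B, hA0, hB0, hAB, hkpq⟩ := hkseg
  obtain ⟨h, hhk, hlt, hle⟩ :=
    exists_support_of_notMem_interior hKconv (mem_interior_iff_mem_nhds.2 hK0) hkint
  have hpK := hle p (subset_convexHull ℝ _ hpS)
  have hqK := hle q (subset_convexHull ℝ _ hqS)
  have hAh : A * h p + B * h q = 1 := by
    rw [← hhk]
    conv_rhs => rw [← hkpq]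
    simp
  have hhp : h p = 1 := by nlinarith
  have hhq : h q = 1 := by nlinarith
  have hxsec : x ∈ sector p q := ⟨g * A, g * B, by positivity, by positivity, by
    rw [hxk, mul_smul, mul_smul, ← smul_add, hkpq]⟩
  have hkseg : k ∈ openSegment ℝ p q := ⟨A, B, hA0, hB0, hAB, hkpq⟩
  rcases hpS with hpE | hpF
  · rcases hqS with hqE | hqF
    · exact absurd (Or.inl (hE.openSegment_subset hpE hqE hkseg)) hkS
    · exact ⟨p, q, ⟨hpE, hqF, hseg, h, hhp, hhq, hlt, hle⟩, hxsec⟩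
  · rcases hqS with hqE | hqF
    · refine ⟨q, p, ⟨hqE, hpF, ?_, h, hhq, hhp, hlt, hle⟩, sector_comm p q ▸ hxsec⟩
      rwa [openSegment_symm]
    · exact absurd (Or.inr (hF.openSegment_subset hpF hqF hkseg)) hkS

lemma volume_interior_convexHull_diff_le {E F : Set Plane} (hE : Convex ℝ E) (hF : Convex ℝ F)
    (hEc : IsCompact E) (hFc : IsCompact F) (hE0 : E ∈ nhds 0) (hF0 : F ∈ nhds 0)
    (hEF : ∀ x ∈ E, (1 / 10 : ℝ) • x ∈ F) :
    volume (interior (convexHull ℝ (E ∪ F)) \ (E ∪ F)) ≤ 10 * volume (symmDiff E F) := by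
  let C : Set (Set Plane) := {c | ∃ p q, IsBridge E F p q ∧ c = sector p q}
  have hopen : ∀ c ∈ C, IsOpen c := by
    rintro _ ⟨p, q, hpq, rfl⟩
    exact isOpen_sector hpq.cross_ne_zero
  have hdisj : C.PairwiseDisjoint id := by
    rintro _ ⟨p, q, hpq, rfl⟩ _ ⟨p', q', hpq', rfl⟩ hne
    exact (hpq.sector_eq_or_disjoint hpq').resolve_left hne
  have hcount : C.Countable := hdisj.countable_of_isOpen hopen (by
    rintro _ ⟨p, q, -, rfl⟩
    exact ⟨_, 1, 1, one_pos, one_pos, rfl⟩)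
  have hmeas : MeasurableSet (symmDiff E F) :=
    hEc.isClosed.measurableSet.symmDiff hFc.isClosed.measurableSet
  calc volume (interior (convexHull ℝ (E ∪ F)) \ (E ∪ F))
      ≤ volume (⋃ c ∈ C, (interior (convexHull ℝ (E ∪ F)) \ (E ∪ F)) ∩ c) := by
        refine measure_mono fun x hx => ?_
        obtain ⟨p, q, hpq, hxs⟩ := exists_isBridge hE hF hEc hFc hE0 hF0 hx.1 hx.2
        exact mem_biUnion (show sector p q ∈ C from ⟨p, q, hpq, rfl⟩) ⟨hx, hxs⟩
    _ ≤ ∑' c : C, volume ((interior (convexHull ℝ (E ∪ F)) \ (E ∪ F)) ∩ c) :=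
        measure_biUnion_le _ hcount _
    _ ≤ ∑' c : C, 10 * volume (symmDiff E F ∩ c) := by
        refine ENNReal.tsum_le_tsum ?_
        rintro ⟨_, p, q, hpq, rfl⟩
        exact hpq.volume_le hE hF hEc.isClosed hFc.isClosed hE0 hF0 hEF
    _ = 10 * volume (⋃ c ∈ C, symmDiff E F ∩ c) := by
        rw [ENNReal.tsum_mul_left, measure_biUnion (f := fun c => symmDiff E F ∩ c) hcount
          (hdisj.mono fun c => inter_subset_right)
          (fun c hc => hmeas.inter (hopen c hc).measurableSet)]
    _ ≤ 10 * volume (symmDiff E F) := by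
        gcongr
        exact iUnion₂_subset fun c _ => inter_subset_left

/-- An equilateral triangle contains its center in its interior. -/
lemma zero_mem_interior_convexHull {v₁ v₂ v₃ : Plane}
    (h12 : dist v₁ v₂ = 1) (h23 : dist v₂ v₃ = 1) (h31 : dist v₃ v₁ = 1)
    (hbary : v₁ + v₂ + v₃ = 0) : (0 : Plane) ∈ interior (convexHull ℝ {v₁, v₂, v₃}) := by
  have hind : AffineIndependent ℝ ![v₁, v₂, v₃] := by
    rw [affineIndependent_iff_not_collinear_set]
    intro hcol
    rcases hcol.wbtw_or_wbtw_or_wbtw with h | h | h <;>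
      have := h.dist_add_dist <;>
      simp only [dist_comm] at * <;> linarith
  have hspan : affineSpan ℝ (range ![v₁, v₂, v₃]) = ⊤ := by
    rw [hind.affineSpan_eq_top_iff_card_eq_finrank_add_one]
    simp
  have h := AffineBasis.centroid_mem_interior_convexHull ⟨![v₁, v₂, v₃], hind, hspan⟩
  have hc : Finset.centroid ℝ Finset.univ ![v₁, v₂, v₃] = 0 := by
    rw [Finset.centroid_def, Finset.affineCombination_eq_linear_combination _ _ _
      (Finset.univ.sum_centroidWeights_eq_one_of_card_ne_zero ℝ (by simp))]
    simp [Fin.sum_univ_three, Finset.centroidWeights, ← smul_add, hbary]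
  have hr : range ![v₁, v₂, v₃] = {v₁, v₂, v₃} := by
    simp only [Matrix.range_cons, Matrix.range_empty, union_empty, insert_eq]
  change Finset.centroid ℝ Finset.univ ![v₁, v₂, v₃] ∈
    interior (convexHull ℝ (range ![v₁, v₂, v₃])) at h
  rwa [hc, hr] at h

lemma diff_subset_frontier_union {E F : Set Plane} :
    closure E \ closure F ⊆ (E \ F) ∪ frontier E := by
  rintro x ⟨hxE, hxF⟩
  by_cases h : x ∈ E
  · exact Or.inl ⟨h, fun h' => hxF (subset_closure h')⟩
  · exact Or.inr ⟨hxE, fun h' => h (interior_subset h')⟩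

lemma volume_symmDiff_closure_le {E F : Set Plane} (hE : Convex ℝ E) (hF : Convex ℝ F) :
    volume (symmDiff (closure E) (closure F)) ≤ volume (symmDiff E F) := by
  have hsub : symmDiff (closure E) (closure F) ⊆ symmDiff E F ∪ (frontier E ∪ frontier F) := by
    rintro x (hx | hx)
    · rcases diff_subset_frontier_union hx with h | h
      · exact Or.inl (Or.inl h)
      · exact Or.inr (Or.inl h)
    · rcases diff_subset_frontier_union hx with h | h
      · exact Or.inl (Or.inr h)
      · exact Or.inr (Or.inr h)
  refine (measure_mono hsub).trans ((measure_union_le _ _).trans_eq ?_)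
  rw [measure_union_null (hE.addHaar_frontier volume) (hF.addHaar_frontier volume), add_zero]

lemma volume_convexHull_diff_le_closure {E F : Set Plane} (hE : Convex ℝ E) (hF : Convex ℝ F) :
    volume (convexHull ℝ (E ∪ F) \ (E ∪ F)) ≤
      volume (interior (convexHull ℝ (closure E ∪ closure F)) \ (closure E ∪ closure F)) := by
  have hsub : convexHull ℝ (E ∪ F) \ (E ∪ F) ⊆
      (interior (convexHull ℝ (closure E ∪ closure F)) \ (closure E ∪ closure F)) ∪
        (frontier (convexHull ℝ (closure E ∪ closure F)) ∪ (frontier E ∪ frontier F)) := by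
    rintro x ⟨hxK, hx⟩
    have hxK' := convexHull_mono (union_subset_union subset_closure subset_closure) hxK
    by_cases hint : x ∈ interior (convexHull ℝ (closure E ∪ closure F))
    · by_cases hcl : x ∈ closure E ∪ closure F
      · rcases hcl with h | h
        · exact Or.inr (Or.inr (Or.inl ⟨h, fun h' => hx (Or.inl (interior_subset h'))⟩))
        · exact Or.inr (Or.inr (Or.inr ⟨h, fun h' => hx (Or.inr (interior_subset h'))⟩))
      · exact Or.inl ⟨hint, hcl⟩
    · exact Or.inr (Or.inl ⟨subset_closure hxK', hint⟩)
  refine (measure_mono hsub).trans ((measure_union_le _ _).trans_eq ?_)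
  rw [measure_union_null ((convex_convexHull ℝ _).addHaar_frontier volume)
    (measure_union_null (hE.addHaar_frontier volume) (hF.addHaar_frontier volume)), add_zero]

/-- For convex E, F of equal area with T ⊆ E ∩ F ⊆ −2T (T a unit equilateral triangle centered
at the origin), |E Δ F| ≤ 1/2 and E, F ⊆ 10T, the convex hull K = co(E ∪ F) satisfies
|K ∖ (E ∪ F)| ≤ 10·|E Δ F|. -/
theorem stmt_11 (v₁ v₂ v₃ : EuclideanSpace ℝ (Fin 2))
    (h12 : dist v₁ v₂ = 1) (h23 : dist v₂ v₃ = 1) (h31 : dist v₃ v₁ = 1)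
    (hbary : v₁ + v₂ + v₃ = 0)
    (E F : Set (EuclideanSpace ℝ (Fin 2))) (hE : Convex ℝ E) (hF : Convex ℝ F)
    (harea : volume E = volume F)
    (hTEF : convexHull ℝ {v₁, v₂, v₃} ⊆ E ∩ F)
    (hEF2T : E ∩ F ⊆ (-2 : ℝ) • convexHull ℝ {v₁, v₂, v₃})
    (hsym : volume (symmDiff E F) ≤ ENNReal.ofReal (1 / 2))
    (hE10 : E ⊆ (10 : ℝ) • convexHull ℝ {v₁, v₂, v₃})
    (hF10 : F ⊆ (10 : ℝ) • convexHull ℝ {v₁, v₂, v₃}) :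
    volume (convexHull ℝ (E ∪ F) \ (E ∪ F)) ≤ 10 * volume (symmDiff E F) := by
  have hT0 := mem_interior_iff_mem_nhds.1 (zero_mem_interior_convexHull h12 h23 h31 hbary)
  have hTc : IsCompact (convexHull ℝ {v₁, v₂, v₃}) :=
    (Set.toFinite _).isCompact_convexHull ℝ
  have hTE := hTEF.trans Set.inter_subset_left
  have hTF := hTEF.trans Set.inter_subset_right
  have hcpt {G : Set Plane} (hG : G ⊆ (10 : ℝ) • convexHull ℝ {v₁, v₂, v₃}) :
      IsCompact (closure G) :=
    ((hTc.smul (10 : ℝ)).isBounded.subset hG).isCompact_closure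
  have hmaps : Set.MapsTo (fun x : Plane => (1 / 10 : ℝ) • x) E F := by
    intro x hx
    obtain ⟨t, ht, rfl⟩ := hE10 hx
    have : (1 / 10 : ℝ) • (10 : ℝ) • t = t := by rw [smul_smul]; norm_num
    simpa only [this] using hTF ht
  have hEF : ∀ x ∈ closure E, (1 / 10 : ℝ) • x ∈ closure F :=
    fun x hx => hmaps.closure (by fun_prop) hx
  calc volume (convexHull ℝ (E ∪ F) \ (E ∪ F))
      ≤ _ := volume_convexHull_diff_le_closure hE hF
    _ ≤ 10 * volume (symmDiff (closure E) (closure F)) :=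
        volume_interior_convexHull_diff_le hE.closure hF.closure (hcpt hE10) (hcpt hF10)
          (Filter.mem_of_superset hT0 (hTE.trans subset_closure))
          (Filter.mem_of_superset hT0 (hTF.trans subset_closure)) hEF
    _ ≤ 10 * volume (symmDiff E F) :=
        mul_le_mul_right (volume_symmDiff_closure_le hE hF) 10
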